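/- Let n be an odd prime and let x, y, z be pairwise relatively prime positive integers with x^n + y^n = z^n. If 2 ∣ z then ν_2(x + y) ≥ n; if 2 ∣ x then ν_2(z − y) ≥ n; if 2 ∣ y then ν_2(z − x) ≥ n. Moreover, if p is an odd prime dividing x that also divides z − y, then ν_p(z − y) ≥ n − 1; the analogous statements hold for odd primes dividing y (with z − x) and odd primes dividing z (with x + y). -/

import Mathlib

theorem aux_first_factor (n : ℕ) (hn : n.Prime) (hnodd : Odd n) (p : ℕ) (hp : p.Prime)
    (a b c : ℤ) (h : a ^ n - b ^ n = c ^ n) (hc : (p : ℤ) ∣ c) (hab : (p : ℤ) ∣ a - b)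
    (ha : ¬ (p : ℤ) ∣ a) (hne : a - b ≠ 0) :
    n - 1 ≤ padicValInt p (a - b) ∧ (p = 2 → n ≤ padicValInt p (a - b)) := by
  haveI := Fact.mk hp
  have hpp : Prime (p : ℤ) := Nat.prime_iff_prime_int.mp hp
  have key : (p : ℤ) ^ n ∣ a ^ n - b ^ n := h ▸ pow_dvd_pow_of_dvd hc n
  have conv : ∀ k : ℕ, (p : ℤ) ^ k ∣ a - b → k ≤ padicValInt p (a - b) := by
    intro k hk
    rcases (padicValInt_dvd_iff k (a - b)).mp hk with h0 | h0
    · exact absurd h0 hne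
    · exact h0
  by_cases hpn : p = n
  · subst hpn
    have e := Int.emultiplicity_pow_sub_pow hp hnodd hab ha p
    have e1 : emultiplicity p p = 1 :=
      (Nat.finiteMultiplicity_iff.mpr ⟨hp.one_lt.ne', hp.pos⟩).emultiplicity_self
    rw [e1] at e
    have k2 := le_emultiplicity_of_pow_dvd key
    rw [e] at k2
    refine ⟨conv _ (pow_dvd_of_le_emultiplicity ?_), fun h2 => ?_⟩
    · have : ((p - 1 : ℕ) : ℕ∞) + 1 ≤ emultiplicity (p : ℤ) (a - b) + 1 := by
        refine le_trans (le_of_eq ?_) k2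
        exact_mod_cast Nat.sub_add_cancel hp.one_le
      exact (ENat.add_le_add_iff_right (by simp)).mp this
    · subst h2
      exact absurd hnodd (by decide)
  · have hpn' : ¬ (p : ℤ) ∣ (n : ℤ) := by
      rw [Int.natCast_dvd_natCast]
      exact fun hd => hpn ((Nat.prime_dvd_prime_iff_eq hp hn).mp hd)
    have e := emultiplicity_pow_sub_pow_of_prime hpp hab ha hpn'
    have k2 := le_emultiplicity_of_pow_dvd key
    rw [e] at k2
    have := conv n (pow_dvd_of_le_emultiplicity k2)
    exact ⟨by omega, fun _ => this⟩

/-- Let `n` be an odd prime and `x, y, z` be pairwise coprime positive integers with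
`x^n + y^n = z^n`. If `2 ∣ z` then `ν_2(x + y) ≥ n`; if `2 ∣ x` then `ν_2(z - y) ≥ n`;
if `2 ∣ y` then `ν_2(z - x) ≥ n`. Moreover, if `p` is an odd prime dividing `x` that also
divides `z - y`, then `ν_p(z - y) ≥ n - 1`; analogously for odd primes dividing `y`
(with `z - x`) and odd primes dividing `z` (with `x + y`). -/
theorem flt_two_adic_and_first_factor (n : ℕ) (hn : n.Prime) (hnodd : Odd n)
    (x y z : ℕ) (hx : 0 < x) (hy : 0 < y) (hz : 0 < z)
    (hxy : Nat.Coprime x y) (hxz : Nat.Coprime x z) (hyz : Nat.Coprime y z)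
    (hflt : x ^ n + y ^ n = z ^ n) :
    (2 ∣ z → n ≤ padicValInt 2 ((x : ℤ) + (y : ℤ))) ∧
    (2 ∣ x → n ≤ padicValInt 2 ((z : ℤ) - (y : ℤ))) ∧
    (2 ∣ y → n ≤ padicValInt 2 ((z : ℤ) - (x : ℤ))) ∧
    (∀ p : ℕ, p.Prime → p ≠ 2 → p ∣ x → (p : ℤ) ∣ (z : ℤ) - (y : ℤ) →
      n - 1 ≤ padicValInt p ((z : ℤ) - (y : ℤ))) ∧
    (∀ p : ℕ, p.Prime → p ≠ 2 → p ∣ y → (p : ℤ) ∣ (z : ℤ) - (x : ℤ) →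
      n - 1 ≤ padicValInt p ((z : ℤ) - (x : ℤ))) ∧
    (∀ p : ℕ, p.Prime → p ≠ 2 → p ∣ z → (p : ℤ) ∣ (x : ℤ) + (y : ℤ) →
      n - 1 ≤ padicValInt p ((x : ℤ) + (y : ℤ))) := by
  have hn0 := hn.ne_zero
  have H : (x : ℤ) ^ n + (y : ℤ) ^ n = (z : ℤ) ^ n := by exact_mod_cast hflt
  have hzy : (z : ℤ) - y ≠ 0 := by
    intro h
    rw [sub_eq_zero.mp h] at H
    have : (0 : ℤ) < (x : ℤ) ^ n := by positivity
    omega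
  have hzx : (z : ℤ) - x ≠ 0 := by
    intro h
    rw [sub_eq_zero.mp h] at H
    have : (0 : ℤ) < (y : ℤ) ^ n := by positivity
    omega
  have hxy0 : (x : ℤ) - (-y) ≠ 0 := by omega
  have cop : ∀ {p a b : ℕ}, p.Prime → Nat.Coprime a b → p ∣ a → ¬ (p : ℤ) ∣ (b : ℤ) := by
    intro p a b hp hab ha hb
    exact Nat.not_coprime_of_dvd_of_dvd hp.one_lt ha (Int.natCast_dvd_natCast.mp hb) hab
  have X : ∀ p : ℕ, p.Prime → p ∣ x → (p : ℤ) ∣ (z : ℤ) - y → _ := fun p hp hd hs =>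
    aux_first_factor n hn hnodd p hp z y x (by linarith) (Int.natCast_dvd_natCast.mpr hd) hs
      (cop hp hxz hd) hzy
  have Y : ∀ p : ℕ, p.Prime → p ∣ y → (p : ℤ) ∣ (z : ℤ) - x → _ := fun p hp hd hs =>
    aux_first_factor n hn hnodd p hp z x y (by linarith) (Int.natCast_dvd_natCast.mpr hd) hs
      (cop hp hyz hd) hzx
  have Z : ∀ p : ℕ, p.Prime → p ∣ z → (p : ℤ) ∣ (x : ℤ) - (-y) → _ := fun p hp hd hs =>
    aux_first_factor n hn hnodd p hp x (-y) z (by rw [hnodd.neg_pow]; linarith)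
      (Int.natCast_dvd_natCast.mpr hd) hs (cop hp hxz.symm hd) hxy0
  simp only [sub_neg_eq_add] at Z
  have par : ∀ {a b : ℕ}, Nat.Coprime a b → 2 ∣ a → b % 2 = 1 := by
    intro a b hab ha
    have := cop Nat.prime_two hab ha
    omega
  refine ⟨fun h => (Z 2 Nat.prime_two h ?_).2 rfl, fun h => (X 2 Nat.prime_two h ?_).2 rfl,
    fun h => (Y 2 Nat.prime_two h ?_).2 rfl, fun p hp _ h hs => (X p hp h hs).1,
    fun p hp _ h hs => (Y p hp h hs).1, fun p hp _ h hs => (Z p hp h hs).1⟩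
  · have := par hxz.symm h
    have := par hyz.symm h
    omega
  · have := par hxz h
    have := par hxy h
    omega
  · have := par hyz h
    have := par hxy.symm h
    omega
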